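/- Let Ω ⊂ {(x,y) ∈ ℝ² : 0 < x, 0 < y, x + y < 1} be open and let ℰ : Ω → ℂ be C² with Re ℰ > 0 on Ω. For k ∈ ℂ ∖ [0,1] define the 2×2 matrices U(x,y,k) = (1/(2 Re ℰ)) [[conj(ℰ_x), λ conj(ℰ_x)],[λ ℰ_x, ℰ_x]] and V(x,y,k) = (1/(2 Re ℰ)) [[conj(ℰ_y), λ^{-1} conj(ℰ_y)],[λ^{-1} ℰ_y, ℰ_y]], where λ = λ(x,y,k). Then ℰ satisfies the hyperbolic Ernst equation on Ω if and only if the zero-curvature equation U_y − V_x + UV − VU = 0 holds on Ω for every k ∈ ℂ ∖ [0,1]. -/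

import Mathlib

open Complex Set MeasureTheory Topology Filter ComplexConjugate

noncomputable section

/-- The triangle `D = {(x,y) : 0 ≤ x, 0 ≤ y, x + y < 1}`. -/
def TriD : Set (ℝ × ℝ) := {p | 0 ≤ p.1 ∧ 0 ≤ p.2 ∧ p.1 + p.2 < 1}

/-- Partial derivative in the first variable. -/
def pdx (f : ℝ → ℝ → ℂ) (x y : ℝ) : ℂ := deriv (fun t => f t y) x

/-- Partial derivative in the second variable. -/
def pdy (f : ℝ → ℝ → ℂ) (x y : ℝ) : ℂ := deriv (fun t => f x t) y

/-- Mixed second partial derivative. -/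
def pdxy (f : ℝ → ℝ → ℂ) (x y : ℝ) : ℂ := pdx (fun a b => pdy f a b) x y

/-- Partial derivative in the first variable (real valued). -/
def pdxR (f : ℝ → ℝ → ℝ) (x y : ℝ) : ℝ := deriv (fun t => f t y) x

/-- Partial derivative in the second variable (real valued). -/
def pdyR (f : ℝ → ℝ → ℝ) (x y : ℝ) : ℝ := deriv (fun t => f x t) y

/-- Mixed second partial derivative (real valued). -/
def pdxyR (f : ℝ → ℝ → ℝ) (x y : ℝ) : ℝ := pdxR (fun a b => pdyR f a b) x y

/-- The hyperbolic Ernst equation at a point. -/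
def ErnstEqAt (E : ℝ → ℝ → ℂ) (x y : ℝ) : Prop :=
  (((E x y).re : ℂ)) * (pdxy E x y - (pdx E x y + pdy E x y) / (2 * (1 - x - y))) =
    pdx E x y * pdy E x y

/-- The Euler–Darboux equation at a point. -/
def EulerDarbouxAt (V : ℝ → ℝ → ℝ) (x y : ℝ) : Prop :=
  pdxyR V x y - (pdxR V x y + pdyR V x y) / (2 * (1 - x - y)) = 0

/-- `λ(x,y,k) = √((k-(1-y))/(k-x))`, principal branch (`Re λ > 0` off the cut). -/
def lam (x y : ℝ) (k : ℂ) : ℂ := ((k - (1 - (y : ℂ))) / (k - (x : ℂ))) ^ (1/2 : ℂ)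

/-- The segment `[0,1]` inside `ℂ`. -/
def seg01 : Set ℂ := (fun t : ℝ => (t : ℂ)) '' Icc 0 1

/-- A `C^n`-solution of the Goursat problem for the hyperbolic Ernst equation in `D`
with data `{E0, E1}`, with regularity exponent `α`. -/
def ErnstSolutionWith (n : ℕ) (α : ℝ) (E : ℝ → ℝ → ℂ) (E0 E1 : ℝ → ℂ) : Prop :=
  ContinuousOn (fun p : ℝ × ℝ => E p.1 p.2) TriD ∧
  ContDiffOn ℝ n (fun p : ℝ × ℝ => E p.1 p.2) (interior TriD) ∧
  (∀ p ∈ interior TriD, ErnstEqAt E p.1 p.2) ∧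
  (∃ g : ℝ × ℝ → ℂ, ContinuousOn g TriD ∧
      ∀ p ∈ interior TriD, g p = ((p.1 ^ α : ℝ) : ℂ) * pdx E p.1 p.2) ∧
  (∃ g : ℝ × ℝ → ℂ, ContinuousOn g TriD ∧
      ∀ p ∈ interior TriD, g p = ((p.2 ^ α : ℝ) : ℂ) * pdy E p.1 p.2) ∧
  (∃ g : ℝ × ℝ → ℂ, ContinuousOn g TriD ∧
      ∀ p ∈ interior TriD, g p = ((p.1 ^ α * p.2 ^ α : ℝ) : ℂ) * pdxy E p.1 p.2) ∧
  (∀ x ∈ Ico (0:ℝ) 1, E x 0 = E0 x) ∧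
  (∀ y ∈ Ico (0:ℝ) 1, E 0 y = E1 y) ∧
  (∀ p ∈ TriD, 0 < (E p.1 p.2).re)

/-- A `C^n`-solution of the Goursat problem for the hyperbolic Ernst equation in `D`
(with regularity exponent `α` existentially quantified over `[0,1)`). -/
def ErnstSolution (n : ℕ) (E : ℝ → ℝ → ℂ) (E0 E1 : ℝ → ℂ) : Prop :=
  ∃ α ∈ Ico (0:ℝ) 1, ErnstSolutionWith n α E E0 E1

/-- A `C^n`-solution of the Goursat problem for the Euler–Darboux equation in `D`
with data `{V0, V1}`, with regularity exponent `α`. -/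
def EDSolutionWith (n : ℕ) (α : ℝ) (V : ℝ → ℝ → ℝ) (V0 V1 : ℝ → ℝ) : Prop :=
  ContinuousOn (fun p : ℝ × ℝ => V p.1 p.2) TriD ∧
  ContDiffOn ℝ n (fun p : ℝ × ℝ => V p.1 p.2) (interior TriD) ∧
  (∀ p ∈ interior TriD, EulerDarbouxAt V p.1 p.2) ∧
  (∃ g : ℝ × ℝ → ℝ, ContinuousOn g TriD ∧
      ∀ p ∈ interior TriD, g p = p.1 ^ α * pdxR V p.1 p.2) ∧
  (∃ g : ℝ × ℝ → ℝ, ContinuousOn g TriD ∧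
      ∀ p ∈ interior TriD, g p = p.2 ^ α * pdyR V p.1 p.2) ∧
  (∃ g : ℝ × ℝ → ℝ, ContinuousOn g TriD ∧
      ∀ p ∈ interior TriD, g p = p.1 ^ α * p.2 ^ α * pdxyR V p.1 p.2) ∧
  (∀ x ∈ Ico (0:ℝ) 1, V x 0 = V0 x) ∧
  (∀ y ∈ Ico (0:ℝ) 1, V 0 y = V1 y)

/-- A `C^n`-solution of the Goursat problem for the Euler–Darboux equation in `D`. -/
def EDSolution (n : ℕ) (V : ℝ → ℝ → ℝ) (V0 V1 : ℝ → ℝ) : Prop :=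
  ∃ α ∈ Ico (0:ℝ) 1, EDSolutionWith n α V V0 V1

/-- The data assumptions (1.5) on a single boundary datum for the Ernst equation. -/
def ErnstData (n : ℕ) (α : ℝ) (E0 : ℝ → ℂ) : Prop :=
  ContinuousOn E0 (Ico 0 1) ∧ ContDiffOn ℝ n E0 (Ioo 0 1) ∧
  (∃ g : ℝ → ℂ, ContinuousOn g (Ico 0 1) ∧
      ∀ x ∈ Ioo (0:ℝ) 1, g x = ((x ^ α : ℝ) : ℂ) * deriv E0 x) ∧
  E0 0 = 1 ∧ (∀ x ∈ Ico (0:ℝ) 1, 0 < (E0 x).re)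

/-- The data assumptions on a single boundary datum for the Euler–Darboux equation. -/
def EDData (n : ℕ) (α : ℝ) (V0 : ℝ → ℝ) : Prop :=
  ContinuousOn V0 (Ico 0 1) ∧ ContDiffOn ℝ n V0 (Ioo 0 1) ∧
  (∃ g : ℝ → ℝ, ContinuousOn g (Ico 0 1) ∧
      ∀ x ∈ Ioo (0:ℝ) 1, g x = x ^ α * deriv V0 x) ∧
  V0 0 = 0

/-- The matrix `U0(x,k)` of the x-part of the Lax pair, built from the boundary datum. -/
def U0mat (E0 : ℝ → ℂ) (x : ℝ) (k : ℂ) : Matrix (Fin 2) (Fin 2) ℂ :=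
  (1 / (2 * ((E0 x).re : ℂ))) •
    !![conj (deriv E0 x), lam x 0 k * conj (deriv E0 x);
       lam x 0 k * deriv E0 x, deriv E0 x]

/-- The matrix `U(x,y,k)` of the Lax pair. -/
def Umat (E : ℝ → ℝ → ℂ) (k : ℂ) (x y : ℝ) : Matrix (Fin 2) (Fin 2) ℂ :=
  (1 / (2 * ((E x y).re : ℂ))) •
    !![conj (pdx E x y), lam x y k * conj (pdx E x y);
       lam x y k * pdx E x y, pdx E x y]

/-- The matrix `V(x,y,k)` of the Lax pair. -/
def Vmat (E : ℝ → ℝ → ℂ) (k : ℂ) (x y : ℝ) : Matrix (Fin 2) (Fin 2) ℂ :=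
  (1 / (2 * ((E x y).re : ℂ))) •
    !![conj (pdy E x y), (lam x y k)⁻¹ * conj (pdy E x y);
       (lam x y k)⁻¹ * pdy E x y, pdy E x y]

/-- Partial derivative in the first variable along a differentiable function of two variables. -/
lemma hasDerivAt_fst_of_differentiableAt {G : Type*} [NormedAddCommGroup G] [NormedSpace ℝ G]
    {F : ℝ × ℝ → G} {x y : ℝ} (hF : DifferentiableAt ℝ F (x, y)) :
    HasDerivAt (fun t => F (t, y)) (fderiv ℝ F (x, y) (1, 0)) x :=
  hF.hasFDerivAt.comp_hasDerivAt x ((hasDerivAt_id x).prodMk (hasDerivAt_const x y))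

/-- Partial derivative in the second variable along a differentiable function of two variables. -/
lemma hasDerivAt_snd_of_differentiableAt {G : Type*} [NormedAddCommGroup G] [NormedSpace ℝ G]
    {F : ℝ × ℝ → G} {x y : ℝ} (hF : DifferentiableAt ℝ F (x, y)) :
    HasDerivAt (fun t => F (x, t)) (fderiv ℝ F (x, y) (0, 1)) y :=
  hF.hasFDerivAt.comp_hasDerivAt y ((hasDerivAt_const y x).prodMk (hasDerivAt_id y))

lemma hasDerivAt_pdx {E : ℝ → ℝ → ℂ} {x y : ℝ}
    (hE : DifferentiableAt ℝ (fun p : ℝ × ℝ => E p.1 p.2) (x, y)) :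
    HasDerivAt (fun t => E t y) (pdx E x y) x :=
  (hasDerivAt_fst_of_differentiableAt hE).differentiableAt.hasDerivAt

lemma hasDerivAt_pdy {E : ℝ → ℝ → ℂ} {x y : ℝ}
    (hE : DifferentiableAt ℝ (fun p : ℝ × ℝ => E p.1 p.2) (x, y)) :
    HasDerivAt (fun t => E x t) (pdy E x y) y :=
  (hasDerivAt_snd_of_differentiableAt hE).differentiableAt.hasDerivAt

/-- A `C²` function has both mixed second partial derivatives, and they agree with `pdxy`. -/
lemma hasDerivAt_mixed_of_contDiffAt {E : ℝ → ℝ → ℂ} {x y : ℝ}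
    (hE : ContDiffAt ℝ 2 (fun p : ℝ × ℝ => E p.1 p.2) (x, y)) :
    HasDerivAt (fun t => pdy E t y) (pdxy E x y) x ∧
      HasDerivAt (fun t => pdx E x t) (pdxy E x y) y := by
  set F : ℝ × ℝ → ℂ := fun p => E p.1 p.2 with hF
  have hev : ∀ᶠ q in 𝓝 (x, y), DifferentiableAt ℝ F q :=
    (hE.eventually (by simp)).mono fun q hq => hq.differentiableAt (by simp)
  have hd : DifferentiableAt ℝ (fderiv ℝ F) (x, y) :=
    (hE.fderiv_right (m := 1) (by norm_num)).differentiableAt (by simp)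
  have hsymm : IsSymmSndFDerivAt ℝ F (x, y) := hE.isSymmSndFDerivAt (by simp)
  have hevx : ∀ᶠ t in 𝓝 x, DifferentiableAt ℝ F (t, y) :=
    (Continuous.prodMk_left y).continuousAt.eventually hev
  have hevy : ∀ᶠ t in 𝓝 y, DifferentiableAt ℝ F (x, t) :=
    (Continuous.prodMk_right x).continuousAt.eventually hev
  have hyx : HasDerivAt (fun t => pdy E t y) (fderiv ℝ (fderiv ℝ F) (x, y) (1, 0) (0, 1)) x := by
    refine HasDerivAt.congr_of_eventuallyEq (f := fun t => fderiv ℝ F (t, y) (0, 1)) ?_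
      (hevx.mono fun t ht => (hasDerivAt_snd_of_differentiableAt ht).deriv)
    simpa using (hasDerivAt_fst_of_differentiableAt hd).clm_apply
      (hasDerivAt_const x ((0, 1) : ℝ × ℝ))
  have hxy : HasDerivAt (fun t => pdx E x t) (fderiv ℝ (fderiv ℝ F) (x, y) (0, 1) (1, 0)) y := by
    refine HasDerivAt.congr_of_eventuallyEq (f := fun t => fderiv ℝ F (x, t) (1, 0)) ?_
      (hevy.mono fun t ht => (hasDerivAt_fst_of_differentiableAt ht).deriv)
    simpa using (hasDerivAt_snd_of_differentiableAt hd).clm_apply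
      (hasDerivAt_const y ((1, 0) : ℝ × ℝ))
  have heq : pdxy E x y = fderiv ℝ (fderiv ℝ F) (x, y) (1, 0) (0, 1) := hyx.deriv
  exact ⟨heq ▸ hyx, by rw [heq, hsymm.eq]; exact hxy⟩

lemma sub_ofReal_ne_zero_of_notMem_seg01 {k : ℂ} (hk : k ∉ seg01) {t : ℝ} (ht : t ∈ Icc (0 : ℝ) 1) :
    k - t ≠ 0 := fun h => hk ⟨t, ht, (sub_eq_zero.mp h).symm⟩

/-- The radicand of `lam` avoids the branch cut of the principal square root. -/
lemma lam_radicand_mem_slitPlane {k : ℂ} (hk : k ∉ seg01) {x y : ℝ} (hx : 0 < x) (hy : 0 < y)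
    (hxy : x + y < 1) : (k - (1 - (y : ℂ))) / (k - x) ∈ slitPlane := by
  have hkx : k - x ≠ 0 := sub_ofReal_ne_zero_of_notMem_seg01 hk ⟨hx.le, by linarith⟩
  by_contra hcon
  set w := (k - (1 - (y : ℂ))) / (k - x) with hw
  rw [mem_slitPlane_iff, not_or, not_lt, not_not] at hcon
  obtain ⟨r, hr⟩ : ∃ r : ℝ, w = r := ⟨w.re, Complex.ext rfl (by simp [hcon.2])⟩
  have hr0 : r ≤ 0 := by simpa [hr] using hcon.1
  have h1r : 0 < 1 - r := by linarith
  refine hk ⟨(1 - y - r * x) / (1 - r), ⟨?_, ?_⟩, ?_⟩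
  · apply div_nonneg _ h1r.le
    nlinarith
  · rw [div_le_one h1r]
    nlinarith
  · have h1rc : (1 - r : ℂ) ≠ 0 := by exact_mod_cast h1r.ne'
    rw [hr, eq_div_iff hkx] at hw
    push_cast
    rw [div_eq_iff h1rc]
    linear_combination hw

/-- The square root formula defining `lam`. -/
lemma lam_sq (x y : ℝ) (k : ℂ) : lam x y k ^ 2 = (k - (1 - (y : ℂ))) / (k - x) := by
  simp [lam]

lemma lam_ne_zero {k : ℂ} (hk : k ∉ seg01) {x y : ℝ} (hx : 0 < x) (hy : 0 < y)
    (hxy : x + y < 1) : lam x y k ≠ 0 := by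
  intro h
  have h2 := lam_sq x y k
  rw [h, zero_pow two_ne_zero] at h2
  exact slitPlane_ne_zero (lam_radicand_mem_slitPlane hk hx hy hxy) h2.symm

lemma one_sub_lam_sq {k : ℂ} {x y : ℝ} (hkx : k - x ≠ 0) :
    1 - lam x y k ^ 2 = (1 - x - y) / (k - x) := by
  rw [lam_sq]
  field_simp
  ring

/-- The derivative of the principal square root along a curve. -/
lemma hasDerivAt_cpow_half {f : ℝ → ℂ} {f' : ℂ} {t : ℝ} (hf : HasDerivAt f f' t)
    (ht : f t ∈ slitPlane) :
    HasDerivAt (fun s => f s ^ (1 / 2 : ℂ)) (f' / (2 * f t ^ (1 / 2 : ℂ))) t := by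
  have h := (Complex.hasStrictDerivAt_cpow_const (c := 1 / 2) ht).hasDerivAt.comp t hf
  refine h.congr_deriv ?_
  rw [show (1 / 2 - 1 : ℂ) = -(1 / 2) by norm_num, Complex.cpow_neg]
  have : f t ^ (1 / 2 : ℂ) ≠ 0 := by simp [Complex.cpow_eq_zero_iff, slitPlane_ne_zero ht]
  field_simp

lemma hasDerivAt_lam_snd {k : ℂ} (hk : k ∉ seg01) {x y : ℝ} (hx : 0 < x) (hy : 0 < y)
    (hxy : x + y < 1) :
    HasDerivAt (fun t => lam x t k) (1 / (2 * lam x y k * (k - x))) y := by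
  have hf : HasDerivAt (fun t : ℝ => (k - (1 - (t : ℂ))) / (k - x)) (1 / (k - x)) y := by
    simpa using (((hasDerivAt_id y).ofReal_comp.const_sub 1).const_sub k).div_const (k - (x : ℂ))
  refine (hasDerivAt_cpow_half hf (lam_radicand_mem_slitPlane hk hx hy hxy)).congr_deriv ?_
  rw [div_div, mul_comm (k - (x : ℂ))]
  rfl

lemma hasDerivAt_inv_lam_fst {k : ℂ} (hk : k ∉ seg01) {x y : ℝ} (hx : 0 < x) (hy : 0 < y)
    (hxy : x + y < 1) :
    HasDerivAt (fun t => (lam t y k)⁻¹) (-(1 / (2 * lam x y k * (k - x)))) x := by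
  have hkx : k - x ≠ 0 := sub_ofReal_ne_zero_of_notMem_seg01 hk ⟨hx.le, by linarith⟩
  have hlam := lam_ne_zero hk hx hy hxy
  have hg : HasDerivAt (fun t : ℝ => k - (t : ℂ)) (-1) x := by
    simpa using (hasDerivAt_id x).ofReal_comp.const_sub k
  have hf := (hasDerivAt_const x (k - (1 - (y : ℂ)))).fun_div hg hkx
  have h : HasDerivAt (fun t => lam t y k) _ x :=
    hasDerivAt_cpow_half hf (lam_radicand_mem_slitPlane hk hx hy hxy)
  refine (h.fun_inv hlam).congr_deriv ?_
  have hsq := lam_sq x y k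
  rw [eq_div_iff hkx] at hsq
  change -(_ / (2 * lam x y k)) / lam x y k ^ 2 = _
  rw [← hsq]
  field_simp
  ring

/-- The derivative of `g / (2 Re f)` along a curve. -/
lemma hasDerivAt_div_two_re {f g : ℝ → ℂ} {f' g' : ℂ} {t : ℝ} (hf : HasDerivAt f f' t)
    (hg : HasDerivAt g g' t) (h0 : (f t).re ≠ 0) :
    HasDerivAt (fun s => 1 / (2 * ((f s).re : ℂ)) * g s)
      (1 / (2 * ((f t).re : ℂ)) * g' - (1 / (2 * ((f t).re : ℂ))) ^ 2 * (f' + conj f') * g t) t := by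
  have hc : ((f t).re : ℂ) ≠ 0 := by exact_mod_cast h0
  have hre (z : ℂ) : 2 * (z.re : ℂ) = z + conj z := by rw [re_eq_add_conj]; ring
  have h2 : HasDerivAt (fun s => 2 * ((f s).re : ℂ)) (f' + conj f') t := by
    simp only [hre]
    exact hf.add hf.star
  simp only [one_div]
  refine ((h2.fun_inv (mul_ne_zero two_ne_zero hc)).fun_mul hg).congr_deriv ?_
  field_simp
  ring

/-- The defect in the Ernst equation, divided by `Re E`. -/
def ernstDefect (E : ℝ → ℝ → ℂ) (x y : ℝ) : ℂ :=
  pdxy E x y - (pdx E x y + pdy E x y) / (2 * (1 - x - y)) -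
    pdx E x y * pdy E x y / ((E x y).re : ℂ)

lemma ernstEqAt_iff_ernstDefect_eq_zero {E : ℝ → ℝ → ℂ} {x y : ℝ} (h0 : (E x y).re ≠ 0) :
    ErnstEqAt E x y ↔ ernstDefect E x y = 0 := by
  have hc : ((E x y).re : ℂ) ≠ 0 := by exact_mod_cast h0
  rw [ErnstEqAt, ernstDefect, sub_eq_zero, eq_div_iff hc, mul_comm]

/-- The curvature of the Lax pair is off-diagonal and proportional to the Ernst defect. -/
lemma curvature_eq {E : ℝ → ℝ → ℂ} {k : ℂ} (hk : k ∉ seg01) {x y : ℝ} (hx : 0 < x) (hy : 0 < y)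
    (hxy : x + y < 1) (hE : ContDiffAt ℝ 2 (fun p : ℝ × ℝ => E p.1 p.2) (x, y))
    (h0 : (E x y).re ≠ 0) :
    (Matrix.of fun i j => pdy (fun a b => Umat E k a b i j) x y) -
        (Matrix.of fun i j => pdx (fun a b => Vmat E k a b i j) x y) +
        Umat E k x y * Vmat E k x y - Vmat E k x y * Umat E k x y =
      ((lam x y k - (lam x y k)⁻¹) / (2 * ((E x y).re : ℂ))) •
        !![0, conj (ernstDefect E x y); ernstDefect E x y, 0] := by
  have hkx : k - x ≠ 0 := sub_ofReal_ne_zero_of_notMem_seg01 hk ⟨hx.le, by linarith⟩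
  have hlam := lam_ne_zero hk hx hy hxy
  have hc : ((E x y).re : ℂ) ≠ 0 := by exact_mod_cast h0
  have hD : (1 - x - y : ℂ) ≠ 0 := by
    have : (1 - x - y : ℝ) ≠ 0 := by linarith
    exact_mod_cast this
  have hdiff := hE.differentiableAt (by simp)
  have hEx := hasDerivAt_pdx hdiff
  have hEy := hasDerivAt_pdy hdiff
  obtain ⟨hyx, hxy'⟩ := hasDerivAt_mixed_of_contDiffAt hE
  have hly := hasDerivAt_lam_snd hk hx hy hxy
  have hlx := hasDerivAt_inv_lam_fst hk hx hy hxy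
  have hinv : 1 / (2 * lam x y k * (k - x)) =
      -(lam x y k - (lam x y k)⁻¹) / (2 * (1 - x - y)) := by
    have h := one_sub_lam_sq (y := y) hkx
    rw [eq_div_iff hkx] at h
    rw [← h] at hD ⊢
    have := left_ne_zero_of_mul hD
    field_simp
    ring
  rw [hinv] at hly hlx
  have U00 : pdy (fun a b => Umat E k a b 0 0) x y = _ :=
    (hasDerivAt_div_two_re hEy hxy'.star h0).deriv
  have U01 : pdy (fun a b => Umat E k a b 0 1) x y = _ :=
    (hasDerivAt_div_two_re hEy (hly.fun_mul hxy'.star) h0).deriv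
  have U10 : pdy (fun a b => Umat E k a b 1 0) x y = _ :=
    (hasDerivAt_div_two_re hEy (hly.fun_mul hxy') h0).deriv
  have U11 : pdy (fun a b => Umat E k a b 1 1) x y = _ :=
    (hasDerivAt_div_two_re hEy hxy' h0).deriv
  have V00 : pdx (fun a b => Vmat E k a b 0 0) x y = _ :=
    (hasDerivAt_div_two_re hEx hyx.star h0).deriv
  have V01 : pdx (fun a b => Vmat E k a b 0 1) x y = _ :=
    (hasDerivAt_div_two_re hEx (hlx.fun_mul hyx.star) h0).deriv
  have V10 : pdx (fun a b => Vmat E k a b 1 0) x y = _ :=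
    (hasDerivAt_div_two_re hEx (hlx.fun_mul hyx) h0).deriv
  have V11 : pdx (fun a b => Vmat E k a b 1 1) x y = _ :=
    (hasDerivAt_div_two_re hEx hyx h0).deriv
  ext i j
  fin_cases i <;> fin_cases j <;>
    simp only [Matrix.sub_apply, Matrix.add_apply, Matrix.of_apply, Matrix.mul_apply,
      Fin.sum_univ_two, Fin.zero_eta, Fin.mk_one, Fin.isValue, U00, U01, U10, U11,
      V00, V01, V10, V11] <;>
    simp [Umat, Vmat, ernstDefect, conj_ofNat] <;>
    field_simp <;>
    ring

/-- The hyperbolic Ernst equation is equivalent to the zero-curvature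
equation U_y − V_x + UV − VU = 0 of its Lax pair, for every k ∈ ℂ ∖ [0,1]. -/
theorem ernst_iff_zero_curvature
    (Ω : Set (ℝ × ℝ)) (hΩ : IsOpen Ω)
    (hsub : Ω ⊆ {p : ℝ × ℝ | 0 < p.1 ∧ 0 < p.2 ∧ p.1 + p.2 < 1})
    (E : ℝ → ℝ → ℂ)
    (hE : ContDiffOn ℝ 2 (fun p : ℝ × ℝ => E p.1 p.2) Ω)
    (hre : ∀ p ∈ Ω, 0 < (E p.1 p.2).re) :
    (∀ p ∈ Ω, ErnstEqAt E p.1 p.2) ↔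
    (∀ k ∉ seg01, ∀ p ∈ Ω,
      (Matrix.of fun i j => pdy (fun a b => Umat E k a b i j) p.1 p.2) -
        (Matrix.of fun i j => pdx (fun a b => Vmat E k a b i j) p.1 p.2) +
        Umat E k p.1 p.2 * Vmat E k p.1 p.2 - Vmat E k p.1 p.2 * Umat E k p.1 p.2 = 0) := by
  have hcurv {k : ℂ} (hk : k ∉ seg01) {p : ℝ × ℝ} (hp : p ∈ Ω) :=
    curvature_eq hk (hsub hp).1 (hsub hp).2.1 (hsub hp).2.2
      (hE.contDiffAt (hΩ.mem_nhds hp)) (hre p hp).ne'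
  constructor
  · intro h k hk p hp
    have h0 := (ernstEqAt_iff_ernstDefect_eq_zero (hre p hp).ne').mp (h p hp)
    rw [hcurv hk hp, h0]
    ext i j
    fin_cases i <;> fin_cases j <;> simp
  · intro h p hp
    obtain ⟨hx, hy, hxy⟩ := hsub hp
    have hk : (2 : ℂ) ∉ seg01 := by
      rintro ⟨t, ht, h2⟩
      have h2' : t = 2 := Complex.ofReal_injective (by simpa using h2)
      linarith [ht.2]
    rw [ernstEqAt_iff_ernstDefect_eq_zero (hre p hp).ne']
    have h10 := congrFun (congrFun ((hcurv hk hp).symm.trans (h 2 hk p hp)) 1) 0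
    have hkx : (2 : ℂ) - p.1 ≠ 0 :=
      sub_ofReal_ne_zero_of_notMem_seg01 hk ⟨hx.le, by linarith⟩
    have hlam := lam_ne_zero hk hx hy hxy
    have hne : lam p.1 p.2 2 - (lam p.1 p.2 2)⁻¹ ≠ 0 := by
      intro h0
      have hsq := one_sub_lam_sq (y := p.2) hkx
      have hD : (1 - p.1 - p.2 : ℂ) ≠ 0 := by
        have : (1 - p.1 - p.2 : ℝ) ≠ 0 := by linarith
        exact_mod_cast this
      refine div_ne_zero hD hkx (hsq.symm.trans ?_)
      field_simp at h0
      linear_combination -h0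
    have hc : ((E p.1 p.2).re : ℂ) ≠ 0 := by exact_mod_cast (hre p hp).ne'
    simpa [hne, hc] using h10
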